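/- Let τ be a faithful positive tracial state on ℂ⟨X⟩, (P_w)_{w∈⟨X⟩_d} a family of orthonormal polynomials of τ at degree d, k ≥ 1, and A = (A_1,…,A_n) a tuple of hermitian k×k complex matrices. Then Λ_{τ,d}(A) is the minimum, in the Loewner order, of the set {(Id⊗τ)(PP⋆) : P ∈ M_k(ℂ⟨X⟩_d), P(A)(I_k) = I_k}; explicitly: (i) Λ_{τ,d}(A) ⪯ (Id⊗τ)(PP⋆) for every P ∈ M_k(ℂ⟨X⟩_d) with P(A)(I_k) = I_k, and (ii) the polynomial P_d := Σ_{w∈⟨X⟩_d} (Λ_{τ,d}(A)·P_w(A)) ⊗ P_w⋆ satisfies P_d(A)(I_k) = I_k and (Id⊗τ)(P_d P_d⋆) = Λ_{τ,d}(A). -/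

import Mathlib

open scoped ComplexOrder Matrix

namespace NCCD

/-- Words in the letters `X_1, …, X_n`, i.e. elements of the free monoid on `n` generators. -/
abbrev Word (n : ℕ) : Type := FreeMonoid (Fin n)

/-- The free unital `*`-algebra `ℂ⟨X_1, …, X_n⟩`, modeled as the monoid algebra of the
free monoid on `n` generators. -/
abbrev NCPoly (n : ℕ) : Type := MonoidAlgebra ℂ (Word n)

/-- The monomial associated to a word. -/
noncomputable def mono {n : ℕ} (w : Word n) : NCPoly n :=
  MonoidAlgebra.of ℂ (Word n) w

/-- The length of a word. -/
def wlen {n : ℕ} (w : Word n) : ℕ := (FreeMonoid.toList w).length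

/-- The involution `⋆` on `ℂ⟨X⟩`: conjugate the coefficients and reverse the words. -/
noncomputable def ncStar {n : ℕ} (f : NCPoly n) : NCPoly n :=
  MonoidAlgebra.ofCoeff (Finsupp.mapDomain
    (fun w => FreeMonoid.ofList (FreeMonoid.toList w).reverse)
    (Finsupp.mapRange (starRingEnd ℂ) (map_zero _) f.coeff))

/-- `τ` is a positive functional: `τ(f⋆ f) ≥ 0` for all `f`. -/
def IsPositive {n : ℕ} (τ : NCPoly n →ₗ[ℂ] ℂ) : Prop :=
  ∀ f : NCPoly n, 0 ≤ τ (ncStar f * f)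

/-- `τ` is tracial: `τ(fg) = τ(gf)`. -/
def IsTracial {n : ℕ} (τ : NCPoly n →ₗ[ℂ] ℂ) : Prop :=
  ∀ f g : NCPoly n, τ (f * g) = τ (g * f)

/-- `τ` is faithful: `τ(f⋆ f) = 0` implies `f = 0`. -/
def IsFaithful {n : ℕ} (τ : NCPoly n →ₗ[ℂ] ℂ) : Prop :=
  ∀ f : NCPoly n, τ (ncStar f * f) = 0 → f = 0

/-- The strict graded lexicographic order on words. -/
def glLt {n : ℕ} (v w : Word n) : Prop :=
  wlen v < wlen w ∨
    (wlen v = wlen w ∧ List.Lex (· < ·) (FreeMonoid.toList v) (FreeMonoid.toList w))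

/-- The graded lexicographic order on words. -/
def glLe {n : ℕ} (v w : Word n) : Prop := glLt v w ∨ v = w

/-- Words of length at most `d`. -/
abbrev WordLE (n d : ℕ) : Type := {w : Word n // wlen w ≤ d}

instance {n : ℕ} : DecidableEq (Word n) := fun a b =>
  decidable_of_iff (FreeMonoid.toList a = FreeMonoid.toList b)
    ⟨fun h => FreeMonoid.toList.injective h, fun h => by rw [h]⟩

instance (n d : ℕ) : Finite (WordLE n d) := by
  apply Finite.of_surjective
    (f := fun p : (k : Fin (d+1)) × (Fin k → Fin n) =>
      (⟨FreeMonoid.ofList (List.ofFn p.2), by simp [wlen]; omega⟩ : WordLE n d))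
  rintro ⟨w, hw⟩
  refine ⟨⟨⟨wlen w, by omega⟩, fun i => (FreeMonoid.toList w).get ⟨i, i.2⟩⟩, ?_⟩
  apply Subtype.ext
  simp [wlen, List.ofFn_get]

noncomputable instance (n d : ℕ) : Fintype (WordLE n d) := Fintype.ofFinite _

/-- The span `ℂ⟨X⟩_d` of the monomials of degree at most `d`. -/
noncomputable def degLE (n d : ℕ) : Submodule ℂ (NCPoly n) :=
  Submodule.span ℂ {p : NCPoly n | ∃ w : Word n, wlen w ≤ d ∧ p = mono w}

end NCCD

namespace NCCD

/-- A family of orthonormal polynomials of a faithful positive tracial state `τ` at degree `d`: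
a family `(P_w)` in `ℂ⟨X⟩_d` with `P_1 = 1`, `τ(P_v⋆ P_w) = δ_{v,w}`, `τ(P_v⋆ w) = 0` whenever
`w <_gl v`, and `τ(P_w⋆ w) > 0`, for all words `v, w` of length at most `d`. -/
def IsONB {n : ℕ} (τ : NCPoly n →ₗ[ℂ] ℂ) (d : ℕ) (P : Word n → NCPoly n) : Prop :=
  (∀ w : Word n, wlen w ≤ d → P w ∈ degLE n d) ∧
  P 1 = 1 ∧
  (∀ v w : Word n, wlen v ≤ d → wlen w ≤ d →
    τ (ncStar (P v) * P w) = if v = w then 1 else 0) ∧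
  (∀ v w : Word n, wlen v ≤ d → wlen w ≤ d → glLt w v → τ (ncStar (P v) * mono w) = 0) ∧
  (∀ w : Word n, wlen w ≤ d → 0 < τ (ncStar (P w) * mono w))

end NCCD

namespace NCCD

/-- Evaluation `A^w` of a word at a tuple of matrices. -/
noncomputable def wordEvalM {n k : ℕ} (A : Fin n → Matrix (Fin k) (Fin k) ℂ) (w : Word n) :
    Matrix (Fin k) (Fin k) ℂ :=
  ((FreeMonoid.toList w).map A).prod

/-- Evaluation `f(A)` of a noncommutative polynomial at a tuple of matrices. -/
noncomputable def polyEvalM {n k : ℕ} (A : Fin n → Matrix (Fin k) (Fin k) ℂ) (f : NCPoly n) :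
    Matrix (Fin k) (Fin k) ℂ :=
  Finsupp.sum f.coeff fun w c => c • wordEvalM A w

/-- `P(A)(I_k)` for the matrix noncommutative polynomial `P = Σ_i a_i ⊗ q_i`. -/
noncomputable def evalId {n k : ℕ} {ι : Type*} [Fintype ι]
    (A : Fin n → Matrix (Fin k) (Fin k) ℂ) (a : ι → Matrix (Fin k) (Fin k) ℂ)
    (q : ι → NCPoly n) : Matrix (Fin k) (Fin k) ℂ :=
  ∑ i, a i * polyEvalM A (q i)

/-- `(Id ⊗ τ)(P P⋆)` for the matrix noncommutative polynomial `P = Σ_i a_i ⊗ q_i`. -/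
noncomputable def idTensorTau {n k : ℕ} {ι : Type*} [Fintype ι] (τ : NCPoly n →ₗ[ℂ] ℂ)
    (a : ι → Matrix (Fin k) (Fin k) ℂ) (q : ι → NCPoly n) : Matrix (Fin k) (Fin k) ℂ :=
  ∑ i, ∑ j, τ (q i * ncStar (q j)) • (a i * (a j)ᴴ)

/-- The Christoffel–Darboux kernel evaluation
`κ_{τ,d}(A,A)(I_k) = Σ_w P_w(A) ⬝ (P_w⋆)(A)`. -/
noncomputable def cdKernel {n k : ℕ} (d : ℕ) (P : Word n → NCPoly n)
    (A : Fin n → Matrix (Fin k) (Fin k) ℂ) : Matrix (Fin k) (Fin k) ℂ :=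
  ∑ w : WordLE n d, polyEvalM A (P w.1) * polyEvalM A (ncStar (P w.1))

end NCCD

namespace NCCD

lemma ncStar_zero {n : ℕ} : ncStar (0 : NCPoly n) = 0 := by
  simp [ncStar]

lemma ncStar_add {n : ℕ} (f g : NCPoly n) : ncStar (f + g) = ncStar f + ncStar g := by
  unfold ncStar
  rw [MonoidAlgebra.coeff_add, Finsupp.mapRange_add (by simp), Finsupp.mapDomain_add,
    MonoidAlgebra.ofCoeff_add]

lemma ncStar_single {n : ℕ} (w : Word n) (c : ℂ) :
    ncStar (MonoidAlgebra.single w c : NCPoly n) =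
      MonoidAlgebra.single (FreeMonoid.ofList (FreeMonoid.toList w).reverse)
        (starRingEnd ℂ c) := by
  unfold ncStar
  rw [MonoidAlgebra.coeff_single, Finsupp.mapRange_single, Finsupp.mapDomain_single,
    MonoidAlgebra.ofCoeff_single]

lemma ncStar_smul {n : ℕ} (c : ℂ) (f : NCPoly n) :
    ncStar (c • f) = starRingEnd ℂ c • ncStar f := by
  induction f using MonoidAlgebra.induction_linear with
  | zero => simp [ncStar_zero]
  | add f g hf hg => rw [smul_add, ncStar_add, ncStar_add, hf, hg, smul_add]
  | single w a => simp [ncStar_single, MonoidAlgebra.smul_single]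

lemma ncStar_ncStar {n : ℕ} (f : NCPoly n) : ncStar (ncStar f) = f := by
  induction f using MonoidAlgebra.induction_linear with
  | zero => simp [ncStar_zero]
  | add f g hf hg => rw [ncStar_add, ncStar_add, hf, hg]
  | single w a => simp [ncStar_single]

lemma ncStar_sum {n : ℕ} {ι : Type*} (s : Finset ι) (f : ι → NCPoly n) :
    ncStar (∑ i ∈ s, f i) = ∑ i ∈ s, ncStar (f i) :=
  map_sum (⟨⟨ncStar, ncStar_zero⟩, ncStar_add⟩ : NCPoly n →+ NCPoly n) f s

lemma polyEvalM_zero {n k : ℕ} (A : Fin n → Matrix (Fin k) (Fin k) ℂ) :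
    polyEvalM A 0 = 0 := by
  simp [polyEvalM]

lemma polyEvalM_add {n k : ℕ} (A : Fin n → Matrix (Fin k) (Fin k) ℂ) (f g : NCPoly n) :
    polyEvalM A (f + g) = polyEvalM A f + polyEvalM A g := by
  unfold polyEvalM
  rw [MonoidAlgebra.coeff_add]
  exact Finsupp.sum_add_index' (by simp) (by intros; rw [add_smul])

lemma polyEvalM_single {n k : ℕ} (A : Fin n → Matrix (Fin k) (Fin k) ℂ) (w : Word n) (c : ℂ) :
    polyEvalM A (MonoidAlgebra.single w c) = c • wordEvalM A w := by
  unfold polyEvalM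
  rw [MonoidAlgebra.coeff_single, Finsupp.sum_single_index (by simp)]

lemma polyEvalM_smul {n k : ℕ} (A : Fin n → Matrix (Fin k) (Fin k) ℂ) (c : ℂ) (f : NCPoly n) :
    polyEvalM A (c • f) = c • polyEvalM A f := by
  induction f using MonoidAlgebra.induction_linear with
  | zero => simp [polyEvalM_zero]
  | add f g hf hg => rw [smul_add, polyEvalM_add, polyEvalM_add, hf, hg, smul_add]
  | single w a => simp [polyEvalM_single, MonoidAlgebra.smul_single, mul_smul]

lemma polyEvalM_sum {n k : ℕ} (A : Fin n → Matrix (Fin k) (Fin k) ℂ)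
    {ι : Type*} (s : Finset ι) (f : ι → NCPoly n) :
    polyEvalM A (∑ i ∈ s, f i) = ∑ i ∈ s, polyEvalM A (f i) :=
  map_sum (⟨⟨polyEvalM A, polyEvalM_zero A⟩, polyEvalM_add A⟩ :
    NCPoly n →+ Matrix (Fin k) (Fin k) ℂ) f s

lemma wordEvalM_rev {n k : ℕ} (A : Fin n → Matrix (Fin k) (Fin k) ℂ)
    (hA : ∀ i, (A i).IsHermitian) (w : Word n) :
    wordEvalM A (FreeMonoid.ofList (FreeMonoid.toList w).reverse) = (wordEvalM A w)ᴴ := by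
  unfold wordEvalM
  rw [Matrix.conjTranspose_list_prod, FreeMonoid.toList_ofList, List.map_reverse, List.map_map]
  congr 3
  funext i
  exact (hA i).eq.symm

lemma polyEvalM_ncStar {n k : ℕ} (A : Fin n → Matrix (Fin k) (Fin k) ℂ)
    (hA : ∀ i, (A i).IsHermitian) (f : NCPoly n) :
    polyEvalM A (ncStar f) = (polyEvalM A f)ᴴ := by
  induction f using MonoidAlgebra.induction_linear with
  | zero => simp [polyEvalM_zero, ncStar_zero]
  | add f g hf hg =>
    rw [ncStar_add, polyEvalM_add, polyEvalM_add, hf, hg, Matrix.conjTranspose_add]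
  | single w a =>
    rw [ncStar_single, polyEvalM_single, polyEvalM_single, wordEvalM_rev A hA,
      Matrix.conjTranspose_smul]
    rfl

/-- The orthonormal polynomials span the polynomials of degree at most `d`. -/
lemma onb_span {n d : ℕ} (τ : NCPoly n →ₗ[ℂ] ℂ) (P : Word n → NCPoly n) (hONB : IsONB τ d P)
    (f : NCPoly n) (hf : f ∈ degLE n d) :
    ∃ m : WordLE n d → ℂ, f = ∑ v, m v • P v.1 := by
  obtain ⟨hdeg, -, horth, -, -⟩ := hONB
  have hli : LinearIndependent ℂ (fun w : WordLE n d => P w.1) := by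
    rw [Fintype.linearIndependent_iff]
    intro g hg v
    have h1 : τ (ncStar (P v.1) * ∑ w, g w • P w.1) = 0 := by rw [hg]; simp
    rw [Finset.mul_sum, map_sum] at h1
    simp only [mul_smul_comm, map_smul, smul_eq_mul] at h1
    rw [Finset.sum_eq_single v] at h1
    · rw [horth v.1 v.1 v.2 v.2] at h1
      simpa using h1
    · intro w _ hw
      rw [horth v.1 w.1 v.2 w.2, if_neg (fun h => hw (Subtype.ext h.symm)), mul_zero]
    · simp
  have hdegeq : degLE n d = Submodule.span ℂ (Set.range fun w : WordLE n d => mono w.1) := by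
    unfold degLE
    congr 1
    ext p
    constructor
    · rintro ⟨w, hw, rfl⟩
      exact ⟨⟨w, hw⟩, rfl⟩
    · rintro ⟨w, rfl⟩
      exact ⟨w.1, w.2, rfl⟩
  have hle : Submodule.span ℂ (Set.range fun w : WordLE n d => P w.1) ≤ degLE n d := by
    rw [Submodule.span_le]
    rintro _ ⟨w, rfl⟩
    exact hdeg w.1 w.2
  have hfin : FiniteDimensional ℂ (degLE n d) := by
    rw [hdegeq]
    exact FiniteDimensional.span_of_finite ℂ (Set.finite_range _)
  have heq : Submodule.span ℂ (Set.range fun w : WordLE n d => P w.1) = degLE n d := by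
    apply Submodule.eq_of_le_of_finrank_le hle
    rw [finrank_span_eq_card hli, hdegeq]
    exact finrank_range_le_card _
  rw [← heq, Submodule.mem_span_range_iff_exists_fun] at hf
  obtain ⟨m, hm⟩ := hf
  exact ⟨m, hm.symm⟩

lemma mono_expand {n d : ℕ} (τ : NCPoly n →ₗ[ℂ] ℂ) (P : Word n → NCPoly n)
    (hONB : IsONB τ d P) (w : WordLE n d) :
    ∃ m : WordLE n d → ℂ, mono w.1 = ∑ v, m v • ncStar (P v.1) := by
  have hmem : ncStar (mono w.1) ∈ degLE n d := by
    apply Submodule.subset_span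
    refine ⟨FreeMonoid.ofList (FreeMonoid.toList w.1).reverse, ?_, ?_⟩
    · simpa [wlen] using w.2
    · simp [mono, MonoidAlgebra.of_apply, ncStar_single]
  obtain ⟨m, hm⟩ := onb_span τ P hONB _ hmem
  refine ⟨fun v => starRingEnd ℂ (m v), ?_⟩
  rw [← ncStar_ncStar (mono w.1), hm, ncStar_sum]
  simp only [ncStar_smul]

lemma evalId_change {n k : ℕ} {ι : Type*} [Fintype ι]
    (A : Fin n → Matrix (Fin k) (Fin k) ℂ) (c : ι → Matrix (Fin k) (Fin k) ℂ)
    (q r : ι → NCPoly n) (M : ι → ι → ℂ) (h : ∀ i, r i = ∑ v, M i v • q v) :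
    evalId A c r = evalId A (fun v => ∑ i, M i v • c i) q := by
  unfold evalId
  simp only [h, polyEvalM_sum, polyEvalM_smul, Finset.mul_sum, Finset.sum_mul,
    mul_smul_comm, smul_mul_assoc]
  exact Finset.sum_comm

lemma idTensorTau_change {n k : ℕ} {ι : Type*} [Fintype ι] (τ : NCPoly n →ₗ[ℂ] ℂ)
    (c : ι → Matrix (Fin k) (Fin k) ℂ)
    (q r : ι → NCPoly n) (M : ι → ι → ℂ) (h : ∀ i, r i = ∑ v, M i v • q v) :
    idTensorTau τ c r = idTensorTau τ (fun v => ∑ i, M i v • c i) q := by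
  unfold idTensorTau
  have hL : ∀ i j, τ (r i * ncStar (r j)) • (c i * (c j)ᴴ) =
      ∑ v, ∑ v', (M i v * starRingEnd ℂ (M j v') * τ (q v * ncStar (q v'))) •
        (c i * (c j)ᴴ) := by
    intro i j
    rw [h i, h j, ncStar_sum, Finset.sum_mul, map_sum, Finset.sum_smul]
    refine Finset.sum_congr rfl fun v _ => ?_
    rw [Finset.mul_sum, map_sum, Finset.sum_smul]
    refine Finset.sum_congr rfl fun v' _ => ?_
    rw [ncStar_smul, smul_mul_assoc, mul_smul_comm, map_smul, map_smul, smul_eq_mul, smul_eq_mul,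
      mul_assoc]
  have hR : ∀ v v', τ (q v * ncStar (q v')) • ((∑ i, M i v • c i) * (∑ i, M i v' • c i)ᴴ) =
      ∑ i, ∑ j, (M i v * starRingEnd ℂ (M j v') * τ (q v * ncStar (q v'))) •
        (c i * (c j)ᴴ) := by
    intro v v'
    rw [Matrix.conjTranspose_sum, Finset.sum_mul, Finset.smul_sum]
    refine Finset.sum_congr rfl fun i _ => ?_
    rw [Finset.mul_sum, Finset.smul_sum]
    refine Finset.sum_congr rfl fun j _ => ?_
    rw [Matrix.conjTranspose_smul, smul_mul_assoc, mul_smul_comm, smul_smul, smul_smul]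
    congr 1
    rw [starRingEnd_apply]
    ring
  simp only [hL, hR]
  calc _ = ∑ i, ∑ v, ∑ j, ∑ v', (M i v * starRingEnd ℂ (M j v') * τ (q v * ncStar (q v'))) •
        (c i * (c j)ᴴ) := Finset.sum_congr rfl fun i _ => Finset.sum_comm
    _ = ∑ v, ∑ i, ∑ j, ∑ v', (M i v * starRingEnd ℂ (M j v') * τ (q v * ncStar (q v'))) •
        (c i * (c j)ᴴ) := Finset.sum_comm
    _ = ∑ v, ∑ i, ∑ v', ∑ j, (M i v * starRingEnd ℂ (M j v') * τ (q v * ncStar (q v'))) •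
        (c i * (c j)ᴴ) :=
      Finset.sum_congr rfl fun v _ => Finset.sum_congr rfl fun i _ => Finset.sum_comm
    _ = _ := Finset.sum_congr rfl fun v _ => Finset.sum_comm

lemma idTensorTau_onb {n d k : ℕ} (τ : NCPoly n →ₗ[ℂ] ℂ) (P : Word n → NCPoly n)
    (hONB : IsONB τ d P) (b : WordLE n d → Matrix (Fin k) (Fin k) ℂ) :
    idTensorTau τ b (fun w : WordLE n d => ncStar (P w.1)) = ∑ w, b w * (b w)ᴴ := by
  unfold idTensorTau
  refine Finset.sum_congr rfl fun v _ => ?_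
  rw [Finset.sum_eq_single v]
  · rw [ncStar_ncStar, hONB.2.2.1 v.1 v.1 v.2 v.2]
    simp
  · intro w _ hw
    rw [ncStar_ncStar, hONB.2.2.1 v.1 w.1 v.2 w.2, if_neg (fun h => hw (Subtype.ext h.symm)),
      zero_smul]
  · simp

lemma cdKernel_posDef {n d k : ℕ} (τ : NCPoly n →ₗ[ℂ] ℂ) (P : Word n → NCPoly n)
    (hONB : IsONB τ d P) (A : Fin n → Matrix (Fin k) (Fin k) ℂ) (hA : ∀ i, (A i).IsHermitian) :
    (cdKernel d P A).PosDef := by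
  classical
  unfold cdKernel
  simp only [polyEvalM_ncStar A hA]
  have h0 : wlen (1 : Word n) ≤ d := by simp [wlen]
  rw [← Finset.add_sum_erase _ _ (Finset.mem_univ (⟨1, h0⟩ : WordLE n d))]
  have h1 : polyEvalM A (P 1) = 1 := by
    rw [hONB.2.1, MonoidAlgebra.one_def, polyEvalM_single]
    simp [wordEvalM]
  apply Matrix.PosDef.add_posSemidef
  · simp only [h1, Matrix.conjTranspose_one, mul_one]
    exact Matrix.PosDef.one
  · exact Matrix.posSemidef_sum _ fun w _ => Matrix.posSemidef_self_mul_conjTranspose _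

/-- The noncommutative Christoffel function
`Λ_{τ,d}(A) = (κ_{τ,d}(A,A)(I_k))⁻¹` is the minimum, in the Loewner order, of
`(Id⊗τ)(P P⋆)` over all `P ∈ M_k(ℂ⟨X⟩_d)` with `P(A)(I_k) = I_k`; the minimum is attained at
`P_d = Σ_w (Λ_{τ,d}(A) P_w(A)) ⊗ P_w⋆`. -/
theorem christoffel_function_min {n d k : ℕ} (hk : 1 ≤ k) (τ : NCPoly n →ₗ[ℂ] ℂ)
    (hpos : IsPositive τ) (htr : IsTracial τ) (hstate : τ 1 = 1) (hfaith : IsFaithful τ)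
    (P : Word n → NCPoly n) (hONB : IsONB τ d P)
    (A : Fin n → Matrix (Fin k) (Fin k) ℂ) (hA : ∀ i, (A i).IsHermitian) :
    (∀ c : WordLE n d → Matrix (Fin k) (Fin k) ℂ,
      evalId A c (fun w : WordLE n d => mono w.1) = 1 →
      (idTensorTau τ c (fun w : WordLE n d => mono w.1) - (cdKernel d P A)⁻¹).PosSemidef) ∧
    evalId A (fun w : WordLE n d => (cdKernel d P A)⁻¹ * polyEvalM A (P w.1))
        (fun w : WordLE n d => ncStar (P w.1)) = 1 ∧
    idTensorTau τ (fun w : WordLE n d => (cdKernel d P A)⁻¹ * polyEvalM A (P w.1))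
        (fun w : WordLE n d => ncStar (P w.1)) = (cdKernel d P A)⁻¹ := by
  have hpd := cdKernel_posDef τ P hONB A hA
  have hdet : IsUnit (cdKernel d P A).det := (Matrix.isUnit_iff_isUnit_det _).1 hpd.isUnit
  have hherm : ((cdKernel d P A)⁻¹)ᴴ = (cdKernel d P A)⁻¹ := hpd.inv.isHermitian.eq
  have hker : cdKernel d P A =
      ∑ w : WordLE n d, polyEvalM A (P w.1) * (polyEvalM A (P w.1))ᴴ := by
    unfold cdKernel
    simp only [polyEvalM_ncStar A hA]
  have hLK : (cdKernel d P A)⁻¹ * cdKernel d P A = 1 := Matrix.nonsing_inv_mul _ hdet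
  generalize hL : (cdKernel d P A)⁻¹ = L at *
  have hsum : ∑ w : WordLE n d, (L * polyEvalM A (P w.1)) * (L * polyEvalM A (P w.1))ᴴ = L := by
    simp only [Matrix.conjTranspose_mul, hherm]
    calc _ = ∑ w : WordLE n d, L * (polyEvalM A (P w.1) * (polyEvalM A (P w.1))ᴴ) * L :=
          Finset.sum_congr rfl fun w _ => by simp only [mul_assoc]
      _ = L * cdKernel d P A * L := by rw [← Finset.sum_mul, ← Finset.mul_sum, ← hker]
      _ = L := by rw [hLK, one_mul]
  refine ⟨?_, ?_, ?_⟩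
  · intro c hc
    choose M hM using mono_expand τ P hONB
    rw [evalId_change A c (fun w : WordLE n d => ncStar (P w.1)) _ M hM] at hc
    rw [idTensorTau_change τ c (fun w : WordLE n d => ncStar (P w.1)) _ M hM]
    generalize (fun v : WordLE n d => ∑ i, M i v • c i) = b at *
    rw [idTensorTau_onb τ P hONB]
    unfold evalId at hc
    simp only [polyEvalM_ncStar A hA] at hc
    have hc' : ∑ w : WordLE n d, polyEvalM A (P w.1) * (b w)ᴴ = 1 := by
      have := congrArg Matrix.conjTranspose hc
      simpa [Matrix.conjTranspose_sum, Matrix.conjTranspose_mul] using this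
    have key : ∑ w, b w * (b w)ᴴ - L =
        ∑ w : WordLE n d, (b w - L * polyEvalM A (P w.1)) *
          (b w - L * polyEvalM A (P w.1))ᴴ := by
      have hx : ∑ w : WordLE n d, b w * (L * polyEvalM A (P w.1))ᴴ = L := by
        simp only [Matrix.conjTranspose_mul, hherm, ← mul_assoc]
        rw [← Finset.sum_mul, hc, one_mul]
      have hy : ∑ w : WordLE n d, (L * polyEvalM A (P w.1)) * (b w)ᴴ = L := by
        simp only [mul_assoc]
        rw [← Finset.mul_sum, hc', mul_one]
      simp only [Matrix.conjTranspose_sub, sub_mul, mul_sub, Finset.sum_sub_distrib]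
      rw [hx, hy, hsum]
      abel
    rw [key]
    exact Matrix.posSemidef_sum _ fun w _ => Matrix.posSemidef_self_mul_conjTranspose _
  · unfold evalId
    simp only [polyEvalM_ncStar A hA, mul_assoc]
    rw [← Finset.mul_sum, ← hker, hLK]
  · rw [idTensorTau_onb τ P hONB, hsum]

end NCCD
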